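/- arXiv:1508.07734 — 5 statements merged into one kernel-verified Lean document; each statement's English description precedes it below -/
import Mathlib

section
/- Let X be a normal Hausdorff space and let 𝔍 be an ideal in X with respect to which X is locally null. Then: (a) C^𝔍_00(X) is an ideal of the algebra C_B(X); (b) λ_𝔍X is an open subspace of βX (hence locally compact Hausdorff) containing X as a dense subspace; (c) the map sending f ∈ C^𝔍_00(X) to the restriction of f_β to λ_𝔍X is an isometric isomorphism of C^𝔍_00(X) onto C_00(λ_𝔍X); (d) C^𝔍_00(X) has a multiplicative unit if and only if X ∈ 𝔍, if and only if λ_𝔍X is compact. -/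
open Set Filter Topology BoundedContinuousFunction

noncomputable section

/-- A (set-theoretic) ideal in a set `X`: a nonempty collection of subsets of `X` closed under
taking subsets and finite unions. -/
def IsSetIdeal {X : Type*} (I : Set (Set X)) : Prop :=
  I.Nonempty ∧ (∀ A B : Set X, A ⊆ B → B ∈ I → A ∈ I) ∧
    ∀ A B : Set X, A ∈ I → B ∈ I → A ∪ B ∈ I

/-- `A` has a null (i.e. member of `I`) neighborhood in `X`. -/
def HasNullNbhd {X : Type*} [TopologicalSpace X] (I : Set (Set X)) (A : Set X) : Prop :=
  ∃ U ∈ I, A ⊆ interior U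

/-- A cozero-set of `X`. -/
def IsCozeroSet {X : Type*} [TopologicalSpace X] (C : Set X) : Prop :=
  ∃ g : C(X, ℝ), C = {x | g x ≠ 0}

/-- `C^𝔍_00(X)`: bounded continuous functions whose support has a null neighborhood. -/
def CI00 (X : Type*) [TopologicalSpace X] (I : Set (Set X)) : Set (X →ᵇ ℂ) :=
  {f | HasNullNbhd I (closure {x | f x ≠ 0})}

/-- The subspace `λ_𝔍X` of the Stone–Čech compactification `βX`. -/
def lambdaSet (X : Type*) [TopologicalSpace X] (I : Set (Set X)) : Set (StoneCech X) :=
  ⋃ C ∈ {C : Set X | IsCozeroSet C ∧ HasNullNbhd I (closure C)},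
    interior (closure (stoneCechUnit '' C))

theorem IsSetIdeal.empty_mem {X : Type*} {I : Set (Set X)} (hI : IsSetIdeal I) : ∅ ∈ I := by
  obtain ⟨A, hA⟩ := hI.1
  exact hI.2.1 _ A (empty_subset A) hA

section NullNeighborhoods

variable {X : Type*} [TopologicalSpace X] {I : Set (Set X)}

theorem HasNullNbhd.mono {A B : Set X} (h : A ⊆ B) (hB : HasNullNbhd I B) : HasNullNbhd I A := by
  obtain ⟨U, hU, hBU⟩ := hB
  exact ⟨U, hU, h.trans hBU⟩

theorem HasNullNbhd.union (hI : IsSetIdeal I) {A B : Set X} (hA : HasNullNbhd I A)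
    (hB : HasNullNbhd I B) : HasNullNbhd I (A ∪ B) := by
  obtain ⟨U, hU, hAU⟩ := hA
  obtain ⟨V, hV, hBV⟩ := hB
  exact ⟨U ∪ V, hI.2.2 U V hU hV, union_subset
    (hAU.trans (interior_mono subset_union_left)) (hBV.trans (interior_mono subset_union_right))⟩

theorem hasNullNbhd_empty (hI : IsSetIdeal I) : HasNullNbhd I ∅ :=
  ⟨∅, hI.empty_mem, empty_subset _⟩

theorem hasNullNbhd_univ (hI : IsSetIdeal I) : HasNullNbhd I univ ↔ univ ∈ I := by
  refine ⟨fun ⟨U, hU, h⟩ => hI.2.1 _ U (h.trans interior_subset) hU, fun h => ⟨univ, h, ?_⟩⟩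
  simp

/-- The ideal of bounded continuous functions whose support has a null neighborhood. -/
def CI00Ideal (hI : IsSetIdeal I) : Ideal (X →ᵇ ℂ) where
  carrier := CI00 X I
  zero_mem' := by
    simpa [CI00] using hasNullNbhd_empty hI
  add_mem' := by
    intro f g hf hg
    refine (HasNullNbhd.union hI hf hg).mono ?_
    rw [← closure_union]
    refine closure_mono fun x hx => ?_
    by_contra h
    simp only [mem_union, mem_ofPred_eq, not_or, not_not] at h
    exact hx (by simp [h.1, h.2])
  smul_mem' := by
    intro c f hf
    refine HasNullNbhd.mono (closure_mono fun x hx => ?_) hf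
    intro h
    exact hx (by simp [h])

end NullNeighborhoods

section StoneCech

variable {X : Type*} [TopologicalSpace X]

theorem BoundedContinuousFunction.exists_stoneCech_extension (f : X →ᵇ ℂ) :
    ∃ F : StoneCech X →ᵇ ℂ, ∀ x, F (stoneCechUnit x) = f x := by
  have : CompactSpace (Metric.closedBall (0 : ℂ) ‖f‖) :=
    isCompact_iff_compactSpace.mp (isCompact_closedBall _ _)
  let f' : X → Metric.closedBall (0 : ℂ) ‖f‖ :=
    fun x => ⟨f x, by simpa using f.norm_coe_le_norm x⟩
  have hf' : Continuous f' := f.continuous.subtype_mk _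
  refine ⟨BoundedContinuousFunction.mkOfCompact
    ⟨fun y => (stoneCechExtend hf' y).1,
      continuous_subtype_val.comp (continuous_stoneCechExtend hf')⟩, fun x => ?_⟩
  simp [stoneCechExtend_stoneCechUnit, f']

theorem subset_closure_image_stoneCechUnit {V : Set (StoneCech X)} (hV : IsOpen V) :
    V ⊆ closure (stoneCechUnit '' (stoneCechUnit ⁻¹' V)) := by
  rw [image_preimage_eq_inter_range]
  exact Dense.open_subset_closure_inter denseRange_stoneCechUnit hV

variable {I : Set (Set X)}

theorem isOpen_lambdaSet : IsOpen (lambdaSet X I) :=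
  isOpen_biUnion fun _ _ => isOpen_interior

theorem closure_image_subset_lambdaSet [NormalSpace X] {A : Set X}
    (hA : HasNullNbhd I (closure A)) :
    closure (stoneCechUnit '' A) ⊆ lambdaSet X I := by
  obtain ⟨U, hU, hAU⟩ := hA
  obtain ⟨V, hV, hAV, hVU⟩ := normal_exists_closure_subset isClosed_closure isOpen_interior hAU
  obtain ⟨g, hg0, hg1, hg⟩ := exists_continuous_zero_one_of_isClosed hV.isClosed_compl
    isClosed_closure (disjoint_compl_left_iff_subset.mpr hAV)
  let C : Set X := {x | g x ≠ 0}
  have hCV : C ⊆ V := fun x hx => by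
    by_contra h
    exact hx (hg0 h)
  let g' : X → Icc (0 : ℝ) 1 := fun x => ⟨g x, hg x⟩
  have hg' : Continuous g' := g.continuous.subtype_mk _
  let G : StoneCech X → ℝ := fun y => (stoneCechExtend hg' y).1
  have hG : Continuous G := continuous_subtype_val.comp (continuous_stoneCechExtend hg')
  have hGg : ∀ x, G (stoneCechUnit x) = g x := fun x => by
    simp [G, stoneCechExtend_stoneCechUnit, g']
  have hopen : IsOpen (G ⁻¹' Ioi 0) := isOpen_Ioi.preimage hG
  have hsub : closure (stoneCechUnit '' A) ⊆ G ⁻¹' {1} := by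
    refine closure_minimal ?_ (isClosed_singleton.preimage hG)
    rintro _ ⟨x, hx, rfl⟩
    exact (hGg x).trans (hg1 (subset_closure hx))
  have hCcl : G ⁻¹' Ioi 0 ⊆ closure (stoneCechUnit '' C) := by
    refine (subset_closure_image_stoneCechUnit hopen).trans (closure_mono (image_mono ?_))
    intro x hx
    have hx' : 0 < G (stoneCechUnit x) := hx
    rw [hGg] at hx'
    exact hx'.ne'
  intro y hy
  refine mem_biUnion (x := C) ⟨⟨g, rfl⟩, U, hU, (closure_mono hCV).trans hVU⟩
    (interior_maximal hCcl hopen ?_)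
  have hy1 : G y = 1 := hsub hy
  simp [hy1]

theorem range_subset_lambdaSet [NormalSpace X] [T1Space X]
    (hloc : ∀ x : X, ∃ U ∈ I, x ∈ interior U) :
    range (stoneCechUnit : X → StoneCech X) ⊆ lambdaSet X I := by
  rintro _ ⟨x, rfl⟩
  obtain ⟨U, hU, hx⟩ := hloc x
  exact closure_image_subset_lambdaSet (A := {x}) ⟨U, hU, by simpa using hx⟩
    (subset_closure (mem_image_of_mem _ rfl))

theorem IsCompact.hasNullNbhd_preimage [CompletelyRegularSpace X] (hI : IsSetIdeal I)
    {K : Set (StoneCech X)} (hK : IsCompact K) (hKl : K ⊆ lambdaSet X I) :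
    HasNullNbhd I (closure (stoneCechUnit ⁻¹' K)) := by
  refine hK.induction_on (p := fun S => HasNullNbhd I (closure (stoneCechUnit ⁻¹' S))) ?_ ?_ ?_ ?_
  · simpa using hasNullNbhd_empty hI
  · exact fun s t hst ht => ht.mono (closure_mono (preimage_mono hst))
  · intro s t hs ht
    rw [preimage_union, closure_union]
    exact hs.union hI ht
  · intro y hy
    obtain ⟨C, ⟨_, hCU⟩, hyC⟩ := mem_iUnion₂.mp (hKl hy)
    refine ⟨_, mem_nhdsWithin_of_mem_nhds (isOpen_interior.mem_nhds hyC), hCU.mono ?_⟩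
    refine closure_minimal (fun x hx => ?_) isClosed_closure
    rw [isDenseInducing_stoneCechUnit.isInducing.closure_eq_preimage_closure_image C]
    exact interior_subset (s := closure (stoneCechUnit '' C)) hx

theorem denseRange_codRestrict_lambdaSet (h : ∀ x : X, stoneCechUnit x ∈ lambdaSet X I) :
    DenseRange (fun x => (⟨stoneCechUnit x, h x⟩ : lambdaSet X I)) := by
  refine dense_iff_inter_open.mpr fun W hW hWne => ?_
  obtain ⟨x, hx⟩ := (denseRange_stoneCechUnit (α := X)).exists_mem_open
    (isOpen_lambdaSet.isOpenMap_subtype_val W hW) (hWne.image Subtype.val)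
  obtain ⟨y, hyW, hy⟩ := hx
  exact ⟨y, hyW, x, Subtype.ext hy.symm⟩

theorem exists_mem_CI00_apply_eq_one [NormalSpace X] [T1Space X] {x : X} {U : Set X}
    (hU : U ∈ I) (hx : x ∈ interior U) : ∃ f ∈ CI00 X I, f x = 1 := by
  obtain ⟨V, hV, hxV, hVU⟩ := normal_exists_closure_subset isClosed_singleton isOpen_interior
    (singleton_subset_iff.mpr hx)
  obtain ⟨g, hg0, hg1, hg⟩ := exists_continuous_zero_one_of_isClosed hV.isClosed_compl
    isClosed_singleton (disjoint_compl_left_iff_subset.mpr hxV)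
  refine ⟨BoundedContinuousFunction.ofNormedAddCommGroup (fun y => (g y : ℂ))
    (Complex.continuous_ofReal.comp g.continuous) 1 fun y => ?_, ?_, ?_⟩
  · simpa [abs_of_nonneg (hg y).1] using (hg y).2
  · refine ⟨U, hU, (closure_mono fun y hy => ?_).trans hVU⟩
    by_contra h
    exact hy (by simpa using hg0 h)
  · simpa using hg1 (mem_singleton x)

end StoneCech

theorem stmt_0 {X : Type*} [TopologicalSpace X] [NormalSpace X] [T2Space X]
    (𝔍 : Set (Set X)) (hI : IsSetIdeal 𝔍)
    (hloc : ∀ x : X, ∃ U ∈ 𝔍, x ∈ interior U) :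
    -- (a) `C^𝔍_00(X)` is an ideal of `C_B(X)`
    (∃ I : Ideal (X →ᵇ ℂ), (I : Set (X →ᵇ ℂ)) = CI00 X 𝔍) ∧
    -- (b) `λ_𝔍X` is open in `βX` and contains `X` as a dense subspace
    (IsOpen (lambdaSet X 𝔍) ∧
      Set.range (stoneCechUnit : X → StoneCech X) ⊆ lambdaSet X 𝔍 ∧
      Dense {y : ↥(lambdaSet X 𝔍) |
        (y : StoneCech X) ∈ Set.range (stoneCechUnit : X → StoneCech X)}) ∧
    -- (c) `f ↦ f_β|_{λ_𝔍X}` is an isometric isomorphism of `C^𝔍_00(X)` onto `C_00(λ_𝔍X)`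
    (∃ Φ : (X →ᵇ ℂ) → (↥(lambdaSet X 𝔍) →ᵇ ℂ),
      (∀ f ∈ CI00 X 𝔍, ∀ (x : X) (hx : stoneCechUnit x ∈ lambdaSet X 𝔍),
        Φ f ⟨stoneCechUnit x, hx⟩ = f x) ∧
      (∀ f ∈ CI00 X 𝔍, HasCompactSupport (Φ f : ↥(lambdaSet X 𝔍) → ℂ)) ∧
      (∀ g : ↥(lambdaSet X 𝔍) →ᵇ ℂ, HasCompactSupport (g : ↥(lambdaSet X 𝔍) → ℂ) →
        ∃ f ∈ CI00 X 𝔍, Φ f = g) ∧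
      (∀ f ∈ CI00 X 𝔍, ∀ g ∈ CI00 X 𝔍, Φ f = Φ g → f = g) ∧
      (∀ f ∈ CI00 X 𝔍, ∀ g ∈ CI00 X 𝔍, Φ (f + g) = Φ f + Φ g) ∧
      (∀ f ∈ CI00 X 𝔍, ∀ g ∈ CI00 X 𝔍, Φ (f * g) = Φ f * Φ g) ∧
      (∀ (c : ℂ), ∀ f ∈ CI00 X 𝔍, Φ (c • f) = c • Φ f) ∧
      (∀ f ∈ CI00 X 𝔍, ‖Φ f‖ = ‖f‖)) ∧
    -- (d) unit iff `X ∈ 𝔍` iff `λ_𝔍X` compact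
    ((∃ u ∈ CI00 X 𝔍, ∀ f ∈ CI00 X 𝔍, u * f = f) ↔ Set.univ ∈ 𝔍) ∧
    (Set.univ ∈ 𝔍 ↔ IsCompact (lambdaSet X 𝔍)) := by
  have hmem : ∀ x : X, stoneCechUnit x ∈ lambdaSet X 𝔍 :=
    fun x => range_subset_lambdaSet hloc (mem_range_self x)
  let e : X → lambdaSet X 𝔍 := fun x => ⟨stoneCechUnit x, hmem x⟩
  have he : Continuous e := continuous_stoneCechUnit.subtype_mk _
  have hed : DenseRange e := denseRange_codRestrict_lambdaSet hmem
  have hext : ∀ g h : lambdaSet X 𝔍 →ᵇ ℂ, (∀ x, g (e x) = h (e x)) → g = h := fun g h hgh =>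
    DFunLike.coe_injective (hed.equalizer g.continuous h.continuous (funext hgh))
  refine ⟨⟨CI00Ideal hI, rfl⟩, ⟨isOpen_lambdaSet, range_subset_lambdaSet hloc, ?_⟩, ?_, ?_, ?_⟩
  · refine hed.mono ?_
    rintro _ ⟨x, rfl⟩
    exact mem_range_self x
  · choose F hF using BoundedContinuousFunction.exists_stoneCech_extension (X := X)
    let ι : C(lambdaSet X 𝔍, StoneCech X) := ⟨Subtype.val, continuous_subtype_val⟩
    let Φ : (X →ᵇ ℂ) → (lambdaSet X 𝔍 →ᵇ ℂ) := fun f => (F f).compContinuous ι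
    have hΦ : ∀ f x, Φ f (e x) = f x := fun f x => hF f x
    refine ⟨Φ, fun f _ x _ => hΦ f x, ?_, ?_, ?_, ?_, ?_, ?_, ?_⟩
    · intro f hf
      have hK : closure (stoneCechUnit '' {x | f x ≠ 0}) ⊆ lambdaSet X 𝔍 :=
        closure_image_subset_lambdaSet hf
      refine HasCompactSupport.intro (K := Subtype.val ⁻¹' closure (stoneCechUnit '' {x | f x ≠ 0}))
        ?_ ?_
      · rw [Subtype.isCompact_iff, Subtype.image_preimage_coe, inter_eq_right.mpr hK]
        exact isClosed_closure.isCompact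
      · intro y hy
        by_contra hne
        refine hy (closure_mono (image_mono ?_) (subset_closure_image_stoneCechUnit
          (isOpen_ne.preimage (F f).continuous) (show F f y ≠ 0 from hne)))
        intro x hx
        simpa [hF] using hx
    · intro g hg
      let f : X →ᵇ ℂ := g.compContinuous ⟨e, he⟩
      refine ⟨f, ?_, hext _ _ fun x => hΦ f x⟩
      refine ((hg.isCompact.image continuous_subtype_val).hasNullNbhd_preimage hI ?_).mono
        (closure_mono fun x (hx : g (e x) ≠ 0) => mem_image_of_mem _ (subset_tsupport g hx))
      exact Subtype.coe_image_subset _ _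
    · intro f _ g _ hfg
      ext x
      rw [← hΦ f, ← hΦ g, hfg]
    · exact fun f _ g _ => hext _ _ fun x => by simp [hΦ]
    · exact fun f _ g _ => hext _ _ fun x => by simp [hΦ]
    · exact fun c f _ => hext _ _ fun x => by simp [hΦ]
    · intro f _
      refine le_antisymm ((Φ f).norm_le (norm_nonneg f) |>.mpr fun y => ?_)
        (f.norm_le (norm_nonneg _) |>.mpr fun x => ?_)
      · refine hed.induction_on (p := fun y => ‖Φ f y‖ ≤ ‖f‖) y
          (isClosed_le (Φ f).continuous.norm continuous_const) fun x => ?_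
        rw [hΦ]
        exact f.norm_coe_le_norm x
      · rw [← hΦ f x]
        exact (Φ f).norm_coe_le_norm _
  · constructor
    · rintro ⟨u, hu, hmul⟩
      refine (hasNullNbhd_univ hI).mp (HasNullNbhd.mono (fun x _ => subset_closure ?_) hu)
      obtain ⟨U, hU, hx⟩ := hloc x
      obtain ⟨f, hf, hfx⟩ := exists_mem_CI00_apply_eq_one hU hx
      have h := DFunLike.congr_fun (hmul f hf) x
      intro h0
      simp [h0, hfx] at h
    · intro h
      exact ⟨1, ((hasNullNbhd_univ hI).mpr h).mono (subset_univ _), fun f _ => one_mul f⟩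
  · constructor
    · intro h
      have huniv : closure (stoneCechUnit '' univ) ⊆ lambdaSet X 𝔍 :=
        closure_image_subset_lambdaSet (((hasNullNbhd_univ hI).mpr h).mono (subset_univ _))
      rw [image_univ, denseRange_stoneCechUnit.closure_range, univ_subset_iff] at huniv
      rw [huniv]
      exact isCompact_univ
    · intro h
      refine (hasNullNbhd_univ hI).mp ((h.hasNullNbhd_preimage hI subset_rfl).mono ?_)
      exact fun x _ => subset_closure (hmem x)
end
end

section
/- Let X be a normal Hausdorff space and let 𝔍 be an ideal in X such that for every null subset A of X the closure cl_X A has a null neighborhood in X. Then λ_𝔍X is σ-compact if and only if there exists a countable family V_1, V_2, … of open subsets of X, each belonging to 𝔍, which is cofinal in 𝔍, i.e., every A ∈ 𝔍 is contained in some V_n. -/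
open Set Filter Topology

noncomputable section

/-- In a normal space, every open set `U` containing a closed set `F` contains a cozero-set whose
closure in the Stone–Čech compactification is a neighborhood of the closure of `F`. -/
theorem exists_isCozeroSet_closure_stoneCech_subset {X : Type*} [TopologicalSpace X]
    [NormalSpace X] {F U : Set X} (hF : IsClosed F) (hU : IsOpen U) (hFU : F ⊆ U) :
    ∃ C : Set X, IsCozeroSet C ∧ C ⊆ U ∧
      closure (stoneCechUnit '' F) ⊆ interior (closure (stoneCechUnit '' C)) := by
  obtain ⟨f, hf0, hf1, hf⟩ := exists_continuous_zero_one_of_isClosed hU.isClosed_compl hF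
    (disjoint_left.2 fun x hx hxF => hx (hFU hxF))
  have hg : Continuous fun x => (⟨f x, hf x⟩ : Icc (0 : ℝ) 1) := by fun_prop
  have hext : ∀ x, ((stoneCechExtend hg (stoneCechUnit x) : Icc (0 : ℝ) 1) : ℝ) = f x := by
    intro x
    rw [stoneCechExtend_stoneCechUnit]
  have hcont : Continuous fun p => ((stoneCechExtend hg p : Icc (0 : ℝ) 1) : ℝ) :=
    continuous_subtype_val.comp (continuous_stoneCechExtend hg)
  refine ⟨{x | f x ≠ 0}, ⟨f, rfl⟩, fun x hx => ?_, ?_⟩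
  · by_contra hxU
    exact hx (hf0 hxU)
  have hO : IsOpen {p : StoneCech X | ((stoneCechExtend hg p : Icc (0 : ℝ) 1) : ℝ) ≠ 0} :=
    isOpen_ne_fun hcont continuous_const
  have hsub : {p : StoneCech X | ((stoneCechExtend hg p : Icc (0 : ℝ) 1) : ℝ) ≠ 0} ⊆
      closure (stoneCechUnit '' {x | f x ≠ 0}) := by
    refine (denseRange_stoneCechUnit.open_subset_closure_inter hO).trans (closure_mono ?_)
    rintro _ ⟨hp, x, rfl⟩
    exact ⟨x, fun h0 => hp ((hext x).trans h0), rfl⟩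
  refine Subset.trans ?_ (interior_maximal hsub hO)
  have hone : closure (stoneCechUnit '' F) ⊆
      {p | ((stoneCechExtend hg p : Icc (0 : ℝ) 1) : ℝ) = 1} := by
    refine closure_minimal ?_ (isClosed_eq hcont continuous_const)
    rintro _ ⟨x, hx, rfl⟩
    exact (hext x).trans (hf1 hx)
  intro p hp
  have : ((stoneCechExtend hg p : Icc (0 : ℝ) 1) : ℝ) = 1 := hone hp
  exact ne_of_eq_of_ne this one_ne_zero

/-- If closures of null sets have null neighborhoods, then `lambdaSet X I` contains the closure of
every null set. -/
theorem closure_image_stoneCechUnit_subset_lambdaSet {X : Type*} [TopologicalSpace X]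
    [NormalSpace X] {I : Set (Set X)} (hI : IsSetIdeal I)
    (hnbhd : ∀ A ∈ I, HasNullNbhd I (closure A)) {A : Set X} (hA : A ∈ I) :
    closure (stoneCechUnit '' A) ⊆ lambdaSet X I := by
  obtain ⟨U, hU, hAU⟩ := hnbhd A hA
  obtain ⟨C, hC, hCU, hsub⟩ :=
    exists_isCozeroSet_closure_stoneCech_subset isClosed_closure isOpen_interior hAU
  have hCI : C ∈ I := hI.2.1 C U (hCU.trans interior_subset) hU
  exact (closure_mono (image_mono subset_closure)).trans
    (hsub.trans (subset_biUnion_of_mem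
      (u := fun C : Set X => interior (closure (stoneCechUnit '' C))) ⟨hC, hnbhd C hCI⟩))

theorem HasNullNbhd.mem {X : Type*} [TopologicalSpace X] {I : Set (Set X)} (hI : IsSetIdeal I)
    {A : Set X} (h : HasNullNbhd I (closure A)) : A ∈ I := by
  obtain ⟨U, hU, hAU⟩ := h
  exact hI.2.1 A U (subset_closure.trans (hAU.trans interior_subset)) hU

theorem IsSetIdeal.biUnion_finset_mem {X ι : Type*} {I : Set (Set X)} (hI : IsSetIdeal I)
    (t : Finset ι) {f : ι → Set X} (hf : ∀ i ∈ t, f i ∈ I) : ⋃ i ∈ t, f i ∈ I := by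
  classical
  induction t using Finset.induction_on with
  | empty =>
    obtain ⟨B, hB⟩ := hI.1
    exact hI.2.1 _ B (by simp) hB
  | insert a t _ ih =>
    rw [Finset.set_biUnion_insert]
    exact hI.2.2 _ _ (hf a (Finset.mem_insert_self a t))
      (ih fun i hi => hf i (Finset.mem_insert_of_mem hi))

theorem stmt_3 {X : Type*} [TopologicalSpace X] [NormalSpace X] [T2Space X]
    (𝔍 : Set (Set X)) (hI : IsSetIdeal 𝔍)
    (hnbhd : ∀ A ∈ 𝔍, HasNullNbhd 𝔍 (closure A)) :
    IsSigmaCompact (lambdaSet X 𝔍) ↔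
      ∃ V : ℕ → Set X, (∀ n, IsOpen (V n) ∧ V n ∈ 𝔍) ∧ ∀ A ∈ 𝔍, ∃ n, A ⊆ V n := by
  constructor
  · intro h
    obtain ⟨r, hr, hcov⟩ := h.isLindelof.elim_countable_subcover
      (fun C : {C : Set X // IsCozeroSet C ∧ HasNullNbhd 𝔍 (closure C)} =>
        interior (closure (stoneCechUnit '' (C : Set X))))
      (fun _ => isOpen_interior) (by
        refine iUnion₂_subset fun C hC => ?_
        exact subset_iUnion_of_subset ⟨C, hC⟩ Subset.rfl)
    have : Countable r := hr
    obtain ⟨e, he⟩ := exists_surjective_nat (Finset r)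
    have hnull : ∀ n, ⋃ C ∈ e n, (C.1.1 : Set X) ∈ 𝔍 := fun n =>
      hI.biUnion_finset_mem (e n) fun C _ => C.1.2.2.mem hI
    choose U hU hUsub using fun n => hnbhd _ (hnull n)
    refine ⟨fun n => interior (U n), fun n =>
      ⟨isOpen_interior, hI.2.1 _ _ interior_subset (hU n)⟩, fun A hA => ?_⟩
    have hAcov : closure (stoneCechUnit '' A) ⊆
        ⋃ C : r, interior (closure (stoneCechUnit '' (C.1.1 : Set X))) := by
      have := (closure_image_stoneCechUnit_subset_lambdaSet hI hnbhd hA).trans hcov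
      rwa [biUnion_eq_iUnion] at this
    obtain ⟨t, ht⟩ := isClosed_closure.isCompact.elim_finite_subcover _
      (fun _ => isOpen_interior) hAcov
    obtain ⟨n, rfl⟩ := he t
    refine ⟨n, Subset.trans (fun x hx => ?_) (hUsub n)⟩
    obtain ⟨C, hC, hxC⟩ := mem_iUnion₂.1 (ht (subset_closure (mem_image_of_mem _ hx)))
    have hxC' : x ∈ closure (C.1.1 : Set X) := by
      rw [isEmbedding_stoneCechUnit.closure_eq_preimage_closure_image]
      exact interior_subset (s := closure (stoneCechUnit '' (C.1.1 : Set X))) hxC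
    exact closure_mono (subset_biUnion_of_mem (u := fun C : r => (C.1.1 : Set X)) hC) hxC'
  · rintro ⟨V, hV, hcof⟩
    refine ⟨fun n => closure (stoneCechUnit '' V n), fun n => isClosed_closure.isCompact, ?_⟩
    refine Subset.antisymm (iUnion_subset fun n =>
      closure_image_stoneCechUnit_subset_lambdaSet hI hnbhd (hV n).2) ?_
    refine iUnion₂_subset fun C hC => ?_
    obtain ⟨n, hn⟩ := hcof C (hC.2.mem hI)
    exact interior_subset.trans
      (subset_iUnion_of_subset n (closure_mono (image_mono hn)))
end
end

section
/- Let X be a Tychonoff (completely regular Hausdorff) space and let H be a non-vanishing closed ideal of C_B(X). Then Y = λ_H X = ⋃_{h∈H} cl_{βX}{x ∈ X : |h(x)| > 1} is an open subspace of βX (hence a locally compact Hausdorff space) containing X as a dense subspace, and the map sending h ∈ H to the restriction of h_β to Y is an isometric isomorphism of H onto C_0(Y). -/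
open Set Filter Topology BoundedContinuousFunction

noncomputable section

/-- The subspace `λ_H X = ⋃_{h ∈ H} cl_{βX} {x : |h x| > 1}` of `βX`. -/
def lambdaH {X : Type*} [TopologicalSpace X] (H : Set (X →ᵇ ℂ)) : Set (StoneCech X) :=
  ⋃ h ∈ H, closure (stoneCechUnit '' {x : X | 1 < ‖h x‖})

/-- A function on an open subspace `s` that vanishes at infinity, extended by zero. -/
theorem exists_continuousMap_extend_zero {Z E : Type*} [TopologicalSpace Z] [T2Space Z]
    [TopologicalSpace E] [Zero E] {s : Set Z} (hs : IsOpen s) (g : C(s, E))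
    (hg : Tendsto g (cocompact s) (𝓝 0)) :
    ∃ f : C(Z, E), (∀ y : s, f y = g y) ∧ ∀ y ∉ s, f y = 0 := by
  classical
  let F : Z → E := fun y => if hy : y ∈ s then g ⟨y, hy⟩ else 0
  have hin : ∀ y : s, F y = g y := fun y => dif_pos y.2
  have hout : ∀ y ∉ s, F y = 0 := fun y hy => dif_neg hy
  refine ⟨⟨F, ?_⟩, hin, hout⟩
  refine continuous_iff_continuousAt.2 fun y => ?_
  by_cases hy : y ∈ s
  · have hemb : IsOpenEmbedding ((↑) : s → Z) := hs.isOpenEmbedding_subtypeVal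
    refine (hemb.continuousAt_iff (x := ⟨y, hy⟩)).1 ?_
    have : F ∘ ((↑) : s → Z) = g := funext hin
    rw [this]
    exact g.continuous.continuousAt
  · rw [ContinuousAt, hout y hy]
    intro U hU
    obtain ⟨K, hK, hKU⟩ := mem_cocompact.1 (hg hU)
    have hcl : IsClosed (((↑) : s → Z) '' K) := (hK.image continuous_subtype_val).isClosed
    rw [mem_map]
    filter_upwards [hcl.isOpen_compl.mem_nhds (x := y) (by rintro ⟨z, -, rfl⟩; exact hy z.2)]
      with z hz
    by_cases hzs : z ∈ s
    · have : (⟨z, hzs⟩ : s) ∈ g ⁻¹' U := hKU fun h => hz ⟨_, h, rfl⟩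
      simpa [F, hzs] using this
    · simpa [F, hzs] using mem_of_mem_nhds hU

/-- On an open subspace of a compact space, the restriction of a continuous function vanishing
outside the subspace vanishes at infinity. -/
theorem tendsto_cocompact_restrict {Z E : Type*} [TopologicalSpace Z] [CompactSpace Z]
    [TopologicalSpace E] [Zero E] {s : Set Z} (f : C(Z, E)) (hf : ∀ y ∉ s, f y = 0) :
    Tendsto (fun y : s => f y) (cocompact s) (𝓝 0) := by
  intro U hU
  obtain ⟨V, hVU, hV, h0⟩ := mem_nhds_iff.1 hU
  refine mem_cocompact.2 ⟨((↑) : s → Z) ⁻¹' (f ⁻¹' Vᶜ), ?_, fun y hy => ?_⟩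
  · refine IsInducing.subtypeVal.isCompact_preimage'
      (hV.isClosed_compl.preimage f.continuous).isCompact fun y hy => ?_
    rw [Subtype.range_coe]
    by_contra hys
    exact hy (by rwa [hf y hys])
  · exact hVU (not_not.1 hy)

section

variable {X : Type*} [TopologicalSpace X]

/-- A bounded continuous function as a map into the compact ball of radius its norm. -/
def toClosedBall (h : X →ᵇ ℂ) : C(X, Metric.closedBall (0 : ℂ) ‖h‖) where
  toFun x := ⟨h x, mem_closedBall_zero_iff.2 (h.norm_coe_le_norm x)⟩
  continuous_toFun := h.continuous.subtype_mk _

/-- The continuous extension `h_β : βX → ℂ` of a bounded continuous function. -/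
def betaExtend (h : X →ᵇ ℂ) : C(StoneCech X, ℂ) where
  toFun y := (stoneCechExtend (toClosedBall h).continuous y).1
  continuous_toFun := continuous_subtype_val.comp (continuous_stoneCechExtend _)

theorem betaExtend_unit (h : X →ᵇ ℂ) (x : X) : betaExtend h (stoneCechUnit x) = h x :=
  congrArg Subtype.val (stoneCechExtend_stoneCechUnit (toClosedBall h).continuous x)

theorem norm_betaExtend_le (h : X →ᵇ ℂ) (y : StoneCech X) : ‖betaExtend h y‖ ≤ ‖h‖ :=
  mem_closedBall_zero_iff.1 (stoneCechExtend (toClosedBall h).continuous y).2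

theorem continuousMap_stoneCech_ext {f g : C(StoneCech X, ℂ)}
    (h : ∀ x : X, f (stoneCechUnit x) = g (stoneCechUnit x)) : f = g :=
  DFunLike.coe_injective (stoneCech_hom_ext f.continuous g.continuous (funext h))

/-- Restriction of continuous functions from `βX` to `X`. -/
def betaRestrict : C(StoneCech X, ℂ) →+* (X →ᵇ ℂ) where
  toFun f := (mkOfCompact f).compContinuous ⟨stoneCechUnit, continuous_stoneCechUnit⟩
  map_one' := rfl
  map_mul' _ _ := rfl
  map_zero' := rfl
  map_add' _ _ := rfl

theorem betaRestrict_apply (f : C(StoneCech X, ℂ)) (x : X) :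
    betaRestrict f x = f (stoneCechUnit x) := rfl

theorem continuous_betaRestrict : Continuous (betaRestrict : C(StoneCech X, ℂ) → (X →ᵇ ℂ)) :=
  (continuous_compContinuous _).comp (ContinuousMap.isometryEquivBoundedOfCompact _ _).continuous

theorem betaRestrict_betaExtend (h : X →ᵇ ℂ) : betaRestrict (betaExtend h) = h :=
  BoundedContinuousFunction.ext (betaExtend_unit h)

theorem betaExtend_betaRestrict (f : C(StoneCech X, ℂ)) : betaExtend (betaRestrict f) = f :=
  continuousMap_stoneCech_ext fun x => betaExtend_unit _ x

theorem lambdaH_eq_setOfIdeal (H : Ideal (X →ᵇ ℂ)) :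
    lambdaH (H : Set (X →ᵇ ℂ)) = ContinuousMap.setOfIdeal (H.comap betaRestrict) := by
  ext y
  simp only [lambdaH, mem_iUnion, ContinuousMap.mem_setOfIdeal, Ideal.mem_comap, SetLike.mem_coe,
    exists_prop]
  constructor
  · rintro ⟨h, hh, hy⟩
    refine ⟨betaExtend h, by rwa [betaRestrict_betaExtend], fun h0 => ?_⟩
    have hsub : closure (stoneCechUnit '' {x : X | 1 < ‖h x‖}) ⊆ {y | 1 ≤ ‖betaExtend h y‖} := by
      refine closure_minimal ?_ (isClosed_le continuous_const (betaExtend h).continuous.norm)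
      rintro _ ⟨x, hx, rfl⟩
      simpa [betaExtend_unit] using le_of_lt hx
    have := hsub hy
    simp [h0] at this
    linarith
  · rintro ⟨f, hf, hy⟩
    set c : ℂ := 2 / f y
    refine ⟨betaRestrict (ContinuousMap.const _ c * f), ?_, ?_⟩
    · rw [map_mul]
      exact H.mul_mem_left _ hf
    · have hopen : IsOpen {z : StoneCech X | 1 < ‖c * f z‖} :=
        isOpen_lt continuous_const (by fun_prop)
      have hmem : y ∈ {z : StoneCech X | 1 < ‖c * f z‖} := by simp [c, hy]
      have := denseRange_stoneCechUnit.open_subset_closure_inter hopen hmem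
      refine closure_mono ?_ this
      rintro _ ⟨hz, x, rfl⟩
      exact ⟨x, hz, rfl⟩

theorem mem_iff_betaExtend_eq_zero {H : Ideal (X →ᵇ ℂ)}
    (hH : IsClosed (H : Set (X →ᵇ ℂ))) (h : X →ᵇ ℂ) :
    h ∈ H ↔ ∀ y ∉ lambdaH (H : Set (X →ᵇ ℂ)), betaExtend h y = 0 := by
  have hI : IsClosed ((H.comap betaRestrict : Ideal C(StoneCech X, ℂ)) : Set C(StoneCech X, ℂ)) :=
    hH.preimage continuous_betaRestrict
  conv_lhs => rw [← betaRestrict_betaExtend h, ← Ideal.mem_comap,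
    ← ContinuousMap.idealOfSet_ofIdeal_isClosed hI, ← lambdaH_eq_setOfIdeal,
    ContinuousMap.mem_idealOfSet]
  rfl

end

theorem stmt_7 {X : Type*} [TopologicalSpace X] [T35Space X]
    (H : Ideal (X →ᵇ ℂ)) (hclosed : IsClosed (H : Set (X →ᵇ ℂ)))
    (hnv : ∀ x : X, ∃ h ∈ H, h x ≠ 0) :
    -- `Y = λ_H X` is open in `βX` and contains `X` as a dense subspace
    (IsOpen (lambdaH (H : Set (X →ᵇ ℂ))) ∧
      Set.range (stoneCechUnit : X → StoneCech X) ⊆ lambdaH (H : Set (X →ᵇ ℂ)) ∧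
      Dense {y : ↥(lambdaH (H : Set (X →ᵇ ℂ))) |
        (y : StoneCech X) ∈ Set.range (stoneCechUnit : X → StoneCech X)}) ∧
    -- `h ↦ h_β|_Y` is an isometric isomorphism of `H` onto `C_0(Y)`
    (∃ Φ : (X →ᵇ ℂ) → (↥(lambdaH (H : Set (X →ᵇ ℂ))) →ᵇ ℂ),
      (∀ h ∈ H, ∀ (x : X) (hx : stoneCechUnit x ∈ lambdaH (H : Set (X →ᵇ ℂ))),
        Φ h ⟨stoneCechUnit x, hx⟩ = h x) ∧
      (∀ h ∈ H, Filter.Tendsto (Φ h : ↥(lambdaH (H : Set (X →ᵇ ℂ))) → ℂ)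
        (Filter.cocompact _) (nhds 0)) ∧
      (∀ g : ↥(lambdaH (H : Set (X →ᵇ ℂ))) →ᵇ ℂ,
        Filter.Tendsto (g : ↥(lambdaH (H : Set (X →ᵇ ℂ))) → ℂ) (Filter.cocompact _) (nhds 0) →
        ∃ h ∈ H, Φ h = g) ∧
      (∀ h ∈ H, ∀ h' ∈ H, Φ h = Φ h' → h = h') ∧
      (∀ h ∈ H, ∀ h' ∈ H, Φ (h + h') = Φ h + Φ h') ∧
      (∀ h ∈ H, ∀ h' ∈ H, Φ (h * h') = Φ h * Φ h') ∧
      (∀ (c : ℂ), ∀ h ∈ H, Φ (c • h) = c • Φ h) ∧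
      (∀ h ∈ H, ‖Φ h‖ = ‖h‖)) := by
  have hopen : IsOpen (lambdaH (H : Set (X →ᵇ ℂ))) :=
    lambdaH_eq_setOfIdeal H ▸ ContinuousMap.setOfIdeal_open _
  have hX : ∀ x : X, stoneCechUnit x ∈ lambdaH (H : Set (X →ᵇ ℂ)) := fun x => by
    obtain ⟨h, hh, hx⟩ := hnv x
    by_contra hmem
    exact hx (betaExtend_unit h x ▸ (mem_iff_betaExtend_eq_zero hclosed h).1 hh _ hmem)
  refine ⟨⟨hopen, range_subset_iff.2 hX, ?_⟩, ?_⟩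
  · exact denseRange_stoneCechUnit.preimage hopen.isOpenEmbedding_subtypeVal.isOpenMap
  set ι : C(lambdaH (H : Set (X →ᵇ ℂ)), StoneCech X) := ⟨Subtype.val, continuous_subtype_val⟩
  have hΦ : ∀ h h' : X →ᵇ ℂ, (∀ y : lambdaH (H : Set (X →ᵇ ℂ)),
      betaExtend h y = betaExtend h' y) → h = h' := fun h h' heq =>
    BoundedContinuousFunction.ext fun x => by
      simpa only [betaExtend_unit] using heq ⟨_, hX x⟩
  refine ⟨fun h => (mkOfCompact (betaExtend h)).compContinuous ι,
    fun h _ x hx => betaExtend_unit h x,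
    fun h hh => tendsto_cocompact_restrict _ ((mem_iff_betaExtend_eq_zero hclosed h).1 hh),
    fun g hg => ?_,
    fun h _ h' _ heq => hΦ h h' fun y => DFunLike.congr_fun heq y,
    fun h _ h' _ => ?_, fun h _ h' _ => ?_, fun c h _ => ?_, fun h _ => le_antisymm ?_ ?_⟩
  · obtain ⟨f, hfg, hf0⟩ := exists_continuousMap_extend_zero hopen g.toContinuousMap hg
    refine ⟨betaRestrict f, (mem_iff_betaExtend_eq_zero hclosed _).2 ?_, ?_⟩
    · rwa [betaExtend_betaRestrict]
    · ext y
      simpa [betaExtend_betaRestrict, ι] using hfg y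
  · have : betaExtend (h + h') = betaExtend h + betaExtend h' :=
      continuousMap_stoneCech_ext fun x => by simp [betaExtend_unit]
    simp only [this]
    rfl
  · have : betaExtend (h * h') = betaExtend h * betaExtend h' :=
      continuousMap_stoneCech_ext fun x => by simp [betaExtend_unit]
    simp only [this]
    rfl
  · have : betaExtend (c • h) = c • betaExtend h :=
      continuousMap_stoneCech_ext fun x => by simp [betaExtend_unit]
    simp only [this]
    rfl
  · exact (norm_le (norm_nonneg _)).2 fun y => norm_betaExtend_le h y
  · refine (norm_le (norm_nonneg _)).2 fun x => ?_
    have := norm_coe_le_norm ((mkOfCompact (betaExtend h)).compContinuous ι) ⟨_, hX x⟩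
    rwa [show ((mkOfCompact (betaExtend h)).compContinuous ι) ⟨_, hX x⟩ = h x from
      betaExtend_unit h x] at this
end
end

section
/- Let X be a Tychonoff (completely regular Hausdorff) space and let H be a non-vanishing closed ideal of C_B(X). If λ_H X is σ-compact, then H contains an element g with g(x) ≠ 0 for every x ∈ X. -/
open Set Filter Topology BoundedContinuousFunction

noncomputable section

/-- A countable family in a closed ideal `H` of bounded continuous functions without a common
zero produces an element of `H` without zeros. -/
theorem exists_forall_ne_zero_of_seq {X : Type*} [TopologicalSpace X]
    (H : Ideal (X →ᵇ ℂ)) (hclosed : IsClosed (H : Set (X →ᵇ ℂ)))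
    (h : ℕ → X →ᵇ ℂ) (hH : ∀ n, h n ∈ H) (hne : ∀ x, ∃ n, h n x ≠ 0) :
    ∃ g ∈ H, ∀ x, g x ≠ 0 := by
  set c : ℕ → ℝ := fun n => (1 / 2) ^ n / (‖star (h n) * h n‖ + 1) with hc
  have hcpos : ∀ n, 0 < c n := fun n => by positivity
  set u : ℕ → X →ᵇ ℂ := fun n => (c n : ℂ) • (star (h n) * h n) with hu
  have hux : ∀ n x, u n x = ((c n * ‖h n x‖ ^ 2 : ℝ) : ℂ) := fun n x => by
    simp [hu, Complex.conj_mul']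
  have hsum : Summable u := by
    refine Summable.of_norm_bounded summable_geometric_two fun n => ?_
    rw [hu, norm_smul, Complex.norm_real, Real.norm_of_nonneg (hcpos n).le, hc, div_mul_eq_mul_div]
    refine div_le_of_le_mul₀ (by positivity) (by positivity) ?_
    gcongr
    linarith
  have huH : ∀ n, u n ∈ H := fun n =>
    Submodule.smul_of_tower_mem H (c n : ℂ) (H.mul_mem_left _ (hH n))
  refine ⟨∑' n, u n, hclosed.mem_of_tendsto hsum.hasSum
    (Eventually.of_forall fun s => H.sum_mem fun n _ => huH n), fun x => ?_⟩
  have hx : HasSum (fun n => u n x) ((∑' n, u n) x) :=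
    hsum.hasSum.mapL (BoundedContinuousFunction.evalCLM ℂ x)
  have hre : HasSum (fun n => c n * ‖h n x‖ ^ 2) ((∑' n, u n) x).re := by
    simpa only [BoundedContinuousFunction.evalCLM_apply, hux, Complex.ofReal_re]
      using! Complex.hasSum_re hx
  obtain ⟨m, hm⟩ := hne x
  have hpos : 0 < ((∑' n, u n) x).re :=
    (mul_pos (hcpos m) (by positivity)).trans_le
      (le_hasSum hre m fun n _ => mul_nonneg (hcpos n).le (by positivity))
  exact fun h0 => by simp [h0] at hpos

/-- The extension to the Stone–Čech compactification of `‖h‖` truncated to the unit interval. -/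
def truncNormExtend {X : Type*} [TopologicalSpace X] (h : X →ᵇ ℂ) : StoneCech X → unitInterval :=
  stoneCechExtend (g := fun x => projIcc (0 : ℝ) 1 zero_le_one ‖h x‖)
    (continuous_projIcc.comp h.continuous.norm)

theorem continuous_truncNormExtend {X : Type*} [TopologicalSpace X] (h : X →ᵇ ℂ) :
    Continuous (truncNormExtend h) :=
  continuous_stoneCechExtend _

theorem truncNormExtend_stoneCechUnit {X : Type*} [TopologicalSpace X] (h : X →ᵇ ℂ) (x : X) :
    truncNormExtend h (stoneCechUnit x) = projIcc (0 : ℝ) 1 zero_le_one ‖h x‖ :=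
  stoneCechExtend_stoneCechUnit _ x

theorem truncNormExtend_eq_one {X : Type*} [TopologicalSpace X] (h : X →ᵇ ℂ) {p : StoneCech X}
    (hp : p ∈ closure (stoneCechUnit '' {x : X | 1 < ‖h x‖})) : truncNormExtend h p = 1 := by
  refine closure_minimal (t := truncNormExtend h ⁻¹' {1}) ?_
    (isClosed_singleton.preimage (continuous_truncNormExtend h)) hp
  rintro _ ⟨x, hx, rfl⟩
  exact (truncNormExtend_stoneCechUnit h x).trans (projIcc_of_right_le _ (le_of_lt hx))

theorem stoneCechUnit_mem_lambdaH {X : Type*} [TopologicalSpace X] (H : Ideal (X →ᵇ ℂ)) {x : X}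
    (hx : ∃ h ∈ H, h x ≠ 0) : stoneCechUnit x ∈ lambdaH (H : Set (X →ᵇ ℂ)) := by
  obtain ⟨h, hH, hne⟩ := hx
  refine mem_iUnion₂.2 ⟨(2 / h x : ℂ) • h, Submodule.smul_of_tower_mem H _ hH,
    subset_closure ⟨x, ?_, rfl⟩⟩
  simp [hne]

theorem stmt_9 {X : Type*} [TopologicalSpace X] [T35Space X]
    (H : Ideal (X →ᵇ ℂ)) (hclosed : IsClosed (H : Set (X →ᵇ ℂ)))
    (hnv : ∀ x : X, ∃ h ∈ H, h x ≠ 0)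
    (hsc : IsSigmaCompact (lambdaH (H : Set (X →ᵇ ℂ)))) :
    ∃ g ∈ H, ∀ x : X, g x ≠ 0 := by
  obtain ⟨K, hK, hKU⟩ := hsc
  have hL : IsLindelof (lambdaH (H : Set (X →ᵇ ℂ))) :=
    hKU ▸ isLindelof_iUnion fun n => (hK n).isLindelof
  obtain ⟨r, hr, hcov⟩ := hL.elim_countable_subcover
    (fun h : H => truncNormExtend (h : X →ᵇ ℂ) ⁻¹' Ioi 0)
    (fun h => isOpen_Ioi.preimage (continuous_truncNormExtend _)) fun p hp => by
      obtain ⟨h, hH, hp⟩ := mem_iUnion₂.1 hp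
      refine mem_iUnion.2 ⟨⟨h, hH⟩, ?_⟩
      simp [truncNormExtend_eq_one h hp]
  have hne : ∀ x, ∃ h ∈ r, (h : X →ᵇ ℂ) x ≠ 0 := fun x => by
    obtain ⟨h, hr, hx⟩ := mem_iUnion₂.1 (hcov (stoneCechUnit_mem_lambdaH H (hnv x)))
    refine ⟨h, hr, fun h0 => ?_⟩
    simp [truncNormExtend_stoneCechUnit, h0] at hx
  obtain ⟨f, hf⟩ := (hr.insert 0).exists_eq_range (insert_nonempty _ _)
  refine exists_forall_ne_zero_of_seq H hclosed (fun n => f n) (fun n => (f n).2) fun x => ?_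
  obtain ⟨h, hhr, hx⟩ := hne x
  obtain ⟨n, rfl⟩ := hf ▸ mem_insert_of_mem 0 hhr
  exact ⟨n, hx⟩
end
end

section
/- Let X be a Tychonoff (completely regular Hausdorff) space and let H be a non-vanishing closed ideal of C_B(X). Then λ_H X is connected if and only if H is indecomposable, that is, there do not exist ideals I and J of C_B(X) with I ≠ {0}, J ≠ {0}, I ∩ J = {0}, and H = I + J. -/
open Set Filter Topology BoundedContinuousFunction

noncomputable section

section LambdaSpace

variable {X : Type*} [TopologicalSpace X]

theorem exists_continuous_extend_norm (h : X →ᵇ ℂ) :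
    ∃ g : StoneCech X → ℝ, Continuous g ∧ ∀ x, g (stoneCechUnit x) = ‖h x‖ := by
  let f : X → Icc (0 : ℝ) ‖h‖ := fun x => ⟨‖h x‖, norm_nonneg _, h.norm_coe_le_norm x⟩
  have hf : Continuous f := h.continuous.norm.subtype_mk _
  exact ⟨fun p => (stoneCechExtend hf p : Icc (0 : ℝ) ‖h‖),
    continuous_subtype_val.comp (continuous_stoneCechExtend hf),
    fun x => congrArg Subtype.val (stoneCechExtend_stoneCechUnit hf x)⟩

theorem mem_lambdaH_iff {H : Ideal (X →ᵇ ℂ)} {p : StoneCech X} :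
    p ∈ lambdaH (H : Set (X →ᵇ ℂ)) ↔ ∃ h ∈ H, ∃ g : StoneCech X → ℝ,
      Continuous g ∧ (∀ x, g (stoneCechUnit x) = ‖h x‖) ∧ 0 < g p := by
  simp only [lambdaH, mem_iUnion, SetLike.mem_coe, exists_prop]
  constructor
  · rintro ⟨h, hH, hp⟩
    obtain ⟨g, hg, hgx⟩ := exists_continuous_extend_norm h
    refine ⟨h, hH, g, hg, hgx, zero_lt_one.trans_le ?_⟩
    have hsub : closure (stoneCechUnit '' {x : X | 1 < ‖h x‖}) ⊆ {q | 1 ≤ g q} := by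
      refine closure_minimal ?_ (isClosed_le continuous_const hg)
      rintro _ ⟨x, hx, rfl⟩
      simpa [hgx] using le_of_lt hx
    exact hsub hp
  · rintro ⟨h, hH, g, hg, hgx, hp⟩
    let c : X →ᵇ ℂ := const X ((2 / g p : ℝ) : ℂ)
    refine ⟨c * h, H.mul_mem_left c hH, mem_closure_iff.2 fun o ho hpo => ?_⟩
    have hopen : IsOpen (o ∩ {q | g p / 2 < g q}) := ho.inter (isOpen_lt continuous_const hg)
    obtain ⟨x, hxo, hx⟩ := denseRange_stoneCechUnit.exists_mem_open hopen
      ⟨p, hpo, half_lt_self hp⟩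
    refine ⟨_, hxo, x, ?_, rfl⟩
    rw [mem_ofPred_eq, hgx] at hx
    have hc : ‖c x‖ = 2 / g p := by
      rw [const_apply, Complex.norm_real, Real.norm_of_nonneg (by positivity)]
    rw [mem_ofPred_eq, mul_apply, norm_mul, hc, div_mul_eq_mul_div, one_lt_div hp]
    linarith

theorem isOpen_lambdaH (H : Ideal (X →ᵇ ℂ)) : IsOpen (lambdaH (H : Set (X →ᵇ ℂ))) := by
  refine isOpen_iff_mem_nhds.2 fun p hp => ?_
  obtain ⟨h, hH, g, hg, hgx, hgp⟩ := mem_lambdaH_iff.1 hp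
  filter_upwards [(isOpen_lt continuous_const hg).mem_nhds hgp] with q hq
  exact mem_lambdaH_iff.2 ⟨h, hH, g, hg, hgx, hq⟩

theorem stoneCechUnit_mem_lambdaH_iff {H : Ideal (X →ᵇ ℂ)} {x : X} :
    stoneCechUnit x ∈ lambdaH (H : Set (X →ᵇ ℂ)) ↔ ∃ h ∈ H, h x ≠ 0 := by
  rw [mem_lambdaH_iff]
  constructor
  · rintro ⟨h, hH, g, -, hgx, hp⟩
    exact ⟨h, hH, norm_pos_iff.1 (hgx x ▸ hp)⟩
  · rintro ⟨h, hH, hx⟩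
    obtain ⟨g, hg, hgx⟩ := exists_continuous_extend_norm h
    exact ⟨h, hH, g, hg, hgx, by rw [hgx]; exact norm_pos_iff.2 hx⟩

theorem lambdaH_mono {I H : Ideal (X →ᵇ ℂ)} (hIH : I ≤ H) :
    lambdaH (I : Set (X →ᵇ ℂ)) ⊆ lambdaH (H : Set (X →ᵇ ℂ)) :=
  biUnion_subset_biUnion_left hIH

theorem lambdaH_add_subset (I J : Ideal (X →ᵇ ℂ)) :
    lambdaH ((I + J : Ideal (X →ᵇ ℂ)) : Set (X →ᵇ ℂ)) ⊆
      lambdaH (I : Set (X →ᵇ ℂ)) ∪ lambdaH (J : Set (X →ᵇ ℂ)) := by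
  intro p hp
  obtain ⟨h, hH, g, hg, hgx, hgp⟩ := mem_lambdaH_iff.1 hp
  obtain ⟨i, hi, j, hj, rfl⟩ := Submodule.mem_sup.1 hH
  obtain ⟨gi, hgi, hgix⟩ := exists_continuous_extend_norm i
  obtain ⟨gj, hgj, hgjx⟩ := exists_continuous_extend_norm j
  have hle : g p ≤ gi p + gj p := by
    refine denseRange_stoneCechUnit.induction_on (p := fun q => g q ≤ gi q + gj q) p
      (isClosed_le hg (hgi.add hgj)) fun x => ?_
    rw [hgx, hgix, hgjx]
    exact norm_add_le _ _
  rcases lt_or_ge 0 (gi p) with h0 | h0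
  · exact Or.inl (mem_lambdaH_iff.2 ⟨i, hi, gi, hgi, hgix, h0⟩)
  · exact Or.inr (mem_lambdaH_iff.2 ⟨j, hj, gj, hgj, hgjx, by linarith⟩)

theorem lambdaH_nonempty {I : Ideal (X →ᵇ ℂ)} (hI : I ≠ ⊥) :
    (lambdaH (I : Set (X →ᵇ ℂ))).Nonempty := by
  obtain ⟨i, hi, hi0⟩ := Submodule.exists_mem_ne_zero_of_ne_bot hI
  obtain ⟨x, hx⟩ := DFunLike.ne_iff.1 hi0
  exact ⟨_, stoneCechUnit_mem_lambdaH_iff.2 ⟨i, hi, hx⟩⟩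

theorem lambdaH_inter_eq_empty {I J : Ideal (X →ᵇ ℂ)} (hIJ : I ⊓ J = ⊥) :
    lambdaH (I : Set (X →ᵇ ℂ)) ∩ lambdaH (J : Set (X →ᵇ ℂ)) = ∅ := by
  by_contra hne
  obtain ⟨x, hxI, hxJ⟩ := denseRange_stoneCechUnit.exists_mem_open
    ((isOpen_lambdaH I).inter (isOpen_lambdaH J)) (nonempty_iff_ne_empty.2 hne)
  obtain ⟨i, hi, hix⟩ := stoneCechUnit_mem_lambdaH_iff.1 hxI
  obtain ⟨j, hj, hjx⟩ := stoneCechUnit_mem_lambdaH_iff.1 hxJ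
  have hij : i * j ∈ I ⊓ J := ⟨I.mul_mem_right j hi, J.mul_mem_left i hj⟩
  rw [hIJ, Submodule.mem_bot] at hij
  exact mul_ne_zero hix hjx (DFunLike.congr_fun hij x)

theorem exists_boundedContinuous_indicator {s : Set X} (hs : IsClopen s) :
    ∃ e : X →ᵇ ℂ, (∀ x ∈ s, e x = 1) ∧ ∀ x ∉ s, e x = 0 := by
  classical
  refine ⟨ofNormedAddCommGroup (s.indicator 1) (continuous_one.indicator ?_) 1 fun x => ?_,
    fun x hx => indicator_of_mem hx _, fun x hx => indicator_of_notMem hx _⟩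
  · simp [hs.frontier_eq]
  · by_cases hx : x ∈ s <;> simp [hx]

theorem exists_decomposition_of_isClopen {H : Ideal (X →ᵇ ℂ)} {s : Set X} (hs : IsClopen s)
    (hne : ∃ x ∈ s, ∃ h ∈ H, h x ≠ 0) (hne' : ∃ x ∉ s, ∃ h ∈ H, h x ≠ 0) :
    ∃ I J : Ideal (X →ᵇ ℂ), I ≠ ⊥ ∧ J ≠ ⊥ ∧ I ⊓ J = ⊥ ∧ H = I + J := by
  obtain ⟨e, he1, he0⟩ := exists_boundedContinuous_indicator hs
  have hee : e * e = e := by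
    ext x
    by_cases hx : x ∈ s <;> simp [hx, he1, he0]
  have hann (a : X →ᵇ ℂ) : ∃ I : Ideal (X →ᵇ ℂ), ∀ h, h ∈ I ↔ h ∈ H ∧ a * h = 0 :=
    ⟨H ⊓ LinearMap.ker (LinearMap.mulLeft (X →ᵇ ℂ) a), fun h => by simp⟩
  obtain ⟨I, hI⟩ := hann (1 - e)
  obtain ⟨J, hJ⟩ := hann e
  have heI {h} (hh : h ∈ H) : e * h ∈ I :=
    (hI _).2 ⟨H.mul_mem_left e hh, by linear_combination (-h) * hee⟩
  have heJ {h} (hh : h ∈ H) : (1 - e) * h ∈ J :=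
    (hJ _).2 ⟨H.mul_mem_left _ hh, by linear_combination (-h) * hee⟩
  refine ⟨I, J, ?_, ?_, ?_, le_antisymm (fun h hh => ?_) ?_⟩
  · rintro rfl
    obtain ⟨x, hx, h, hh, hhx⟩ := hne
    have := DFunLike.congr_fun ((Submodule.mem_bot _).1 (heI hh)) x
    simp [he1 x hx, hhx] at this
  · rintro rfl
    obtain ⟨x, hx, h, hh, hhx⟩ := hne'
    have := DFunLike.congr_fun ((Submodule.mem_bot _).1 (heJ hh)) x
    simp [he0 x hx, hhx] at this
  · refine (Submodule.eq_bot_iff _).2 fun h hh => ?_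
    linear_combination ((hI h).1 hh.1).2 + ((hJ h).1 hh.2).2
  · exact Submodule.mem_sup.2 ⟨_, heI hh, _, heJ hh, by ring⟩
  · exact sup_le (fun h hh => ((hI h).1 hh).1) fun h hh => ((hJ h).1 hh).1

end LambdaSpace

theorem stmt_11 {X : Type*} [TopologicalSpace X] [T35Space X]
    (H : Ideal (X →ᵇ ℂ)) (hclosed : IsClosed (H : Set (X →ᵇ ℂ)))
    (hnv : ∀ x : X, ∃ h ∈ H, h x ≠ 0) :
    IsPreconnected (lambdaH (H : Set (X →ᵇ ℂ))) ↔
      ¬ ∃ I J : Ideal (X →ᵇ ℂ), I ≠ ⊥ ∧ J ≠ ⊥ ∧ I ⊓ J = ⊥ ∧ H = I + J := by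
  constructor
  · rintro hpre ⟨I, J, hI, hJ, hIJ, rfl⟩
    obtain ⟨p, -, hp⟩ := hpre _ _ (isOpen_lambdaH I) (isOpen_lambdaH J) (lambdaH_add_subset I J)
      ((lambdaH_nonempty hI).mono (subset_inter (lambdaH_mono le_sup_left) subset_rfl))
      ((lambdaH_nonempty hJ).mono (subset_inter (lambdaH_mono le_sup_right) subset_rfl))
    rwa [lambdaH_inter_eq_empty hIJ] at hp
  · intro hind u v hu hv huv hneu hnev
    by_contra hempty
    have hmem (x : X) : stoneCechUnit x ∈ lambdaH (H : Set (X →ᵇ ℂ)) :=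
      stoneCechUnit_mem_lambdaH_iff.2 (hnv x)
    have hdisj (x : X) (hxu : stoneCechUnit x ∈ u) (hxv : stoneCechUnit x ∈ v) : False :=
      hempty ⟨_, hmem x, hxu, hxv⟩
    have hcompl : (stoneCechUnit ⁻¹' u : Set X)ᶜ = stoneCechUnit ⁻¹' v := by
      ext x
      exact ⟨(huv (hmem x)).resolve_left, fun hxv hxu => hdisj x hxu hxv⟩
    have hclopen : IsClopen (stoneCechUnit ⁻¹' u : Set X) :=
      ⟨isOpen_compl_iff.1 (hcompl ▸ hv.preimage continuous_stoneCechUnit),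
        hu.preimage continuous_stoneCechUnit⟩
    obtain ⟨x, -, hx⟩ := denseRange_stoneCechUnit.exists_mem_open
      ((isOpen_lambdaH H).inter hu) hneu
    obtain ⟨y, -, hy⟩ := denseRange_stoneCechUnit.exists_mem_open
      ((isOpen_lambdaH H).inter hv) hnev
    exact hind (exists_decomposition_of_isClopen hclopen ⟨x, hx, hnv x⟩
      ⟨y, fun hyu => hdisj y hyu hy, hnv y⟩)
end
end
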